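/- For every integer n ≥ 1 and every complex z with Re z > 0: L(ν^{*(n)})(z) = (Ψ(−√z)/√z)ⁿ. In particular, for n = 1: ∫₀^∞ e^{−z·u} · (2/√π)·√u/(2u+1) du = Ψ(−√z)/√z. -/

import Mathlib

open MeasureTheory Set
open scoped Real

/-- The function `Ψ(w) = ∫₀^∞ x·exp(−x²/2 + w·x) dx`. -/
noncomputable def Psi (w : ℂ) : ℂ :=
  ∫ x in Ioi (0:ℝ), (x:ℂ) * Complex.exp (-(x:ℂ)^2/2 + w * x)

/-- The principal branch of the complex square root. -/
noncomputable def csqrt (z : ℂ) : ℂ := z ^ (1/2 : ℂ)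

/-- The Laplace transform `L(f)(z) = ∫₀^∞ exp(−z·u)·f(u) du`. -/
noncomputable def laplace (f : ℝ → ℝ) (z : ℂ) : ℂ :=
  ∫ u in Ioi (0:ℝ), Complex.exp (-z * u) * (f u : ℂ)

/-- The function `ν(u) = (2/√π)·√u/(2u+1)`. -/
noncomputable def nu (u : ℝ) : ℝ := (2 / Real.sqrt π) * Real.sqrt u / (2*u + 1)

/-- Convolution on `(0,∞)`: `(f ∗ g)(u) = ∫₀ᵘ f(s)·g(u−s) ds`. -/
noncomputable def pconv (f g : ℝ → ℝ) (u : ℝ) : ℝ := ∫ s in (0:ℝ)..u, f s * g (u - s)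

/-- The `n`-fold convolution `ν^{*(n)}` of `ν` with itself on `(0,∞)`, for `n ≥ 1`
(the value at `n = 0` is junk). -/
noncomputable def nuPow : ℕ → ℝ → ℝ
  | 0 => fun _ => 0
  | 1 => nu
  | (n+2) => pconv (nuPow (n+1)) nu
/-! ### The principal square root on the right half-plane -/

theorem csqrt_sq (z : ℂ) : csqrt z ^ 2 = z := by
  simp [csqrt]

theorem csqrt_re_pos {z : ℂ} (hz : 0 < z.re) : 0 < (csqrt z).re := by
  have hz0 : z ≠ 0 := by rintro rfl; simp at hz
  have harg : |z.arg| < π / 2 := Complex.abs_arg_lt_pi_div_two_iff.2 (Or.inl hz)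
  rw [abs_lt] at harg
  have him : (Complex.log z * (1 / 2 : ℂ)).im = z.arg / 2 := by
    simp [Complex.mul_im, Complex.log_im]; ring
  rw [csqrt, Complex.cpow_def_of_ne_zero hz0, Complex.exp_re, him]
  have := Real.pi_pos
  exact mul_pos (Real.exp_pos _) (Real.cos_pos_of_mem_Ioo ⟨by linarith, by linarith⟩)

theorem csqrt_ne_zero {z : ℂ} (hz : 0 < z.re) : csqrt z ≠ 0 := by
  intro h
  have := csqrt_re_pos hz
  simp [h] at this

theorem hasDerivAt_csqrt {z : ℂ} (hz : 0 < z.re) :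
    HasDerivAt csqrt (1 / (2 * csqrt z)) z := by
  have h0 := csqrt_ne_zero hz
  have hz0 : z ≠ 0 := by rintro rfl; simp at hz
  have h := (hasDerivAt_id z).cpow_const (c := (1 / 2 : ℂ)) (Or.inl hz)
  refine h.congr_deriv ?_
  simp only [id]
  rw [Complex.cpow_sub _ _ hz0, Complex.cpow_one, mul_one]
  change 1 / 2 * (csqrt z / z) = _
  have := csqrt_sq z
  field_simp
  exact this

theorem sqrt_re_le_norm_csqrt {z : ℂ} : √z.re ≤ ‖csqrt z‖ := by
  apply Real.sqrt_le_iff.2 ⟨norm_nonneg _, ?_⟩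
  rw [← norm_pow, csqrt_sq]
  exact Complex.re_le_norm z

theorem pi_div_cpow_half {z : ℂ} (hz : 0 < z.re) :
    ((π : ℂ) / z) ^ (1 / 2 : ℂ) = (√π : ℝ) / csqrt z := by
  have hz0 : z ≠ 0 := by rintro rfl; simp at hz
  have hpi : (π : ℂ) ≠ 0 := by exact_mod_cast Real.pi_ne_zero
  have harg : z.arg ≠ π := by
    have := (abs_lt.1 (Complex.abs_arg_lt_pi_div_two_iff.2 (Or.inl hz))).2
    have := Real.pi_pos
    intro h
    linarith
  rw [div_eq_mul_inv, Complex.cpow_def_of_ne_zero (mul_ne_zero hpi (inv_ne_zero hz0)),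
    Complex.log_ofReal_mul Real.pi_pos (inv_ne_zero hz0), add_mul, Complex.exp_add,
    Complex.ofReal_log Real.pi_pos.le, ← Complex.cpow_def_of_ne_zero hpi,
    ← Complex.cpow_def_of_ne_zero (inv_ne_zero hz0), Complex.inv_cpow _ _ harg,
    Real.sqrt_eq_rpow, Complex.ofReal_cpow Real.pi_pos.le, div_eq_mul_inv]
  simp [csqrt, div_eq_mul_inv]

/-! ### Moments of Gaussian type -/

theorem integrableOn_pow_mul_exp_neg_mul_sq {b : ℝ} (hb : 0 < b) (k : ℕ) :
    IntegrableOn (fun x : ℝ => x ^ k * Real.exp (-b * x ^ 2)) (Ioi 0) := by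
  have h : (-1 : ℝ) < k := by linarith [(Nat.cast_nonneg k : (0 : ℝ) ≤ k)]
  simpa using integrableOn_rpow_mul_exp_neg_mul_sq hb h

theorem integrableOn_pow_mul_cexp_neg_mul_sq {b : ℂ} (hb : 0 < b.re) (k : ℕ) :
    IntegrableOn (fun x : ℝ => (x : ℂ) ^ k * Complex.exp (-b * (x : ℂ) ^ 2)) (Ioi 0) := by
  refine (integrableOn_pow_mul_exp_neg_mul_sq hb k).mono'
    (by fun_prop) ((ae_restrict_iff' measurableSet_Ioi).2 (.of_forall fun x hx => ?_))
  have hx' : (0 : ℝ) < x := hx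
  rw [norm_mul, norm_pow, Complex.norm_real, Complex.norm_exp, Real.norm_of_nonneg hx'.le]
  have : (-b * (x : ℂ) ^ 2).re = -b.re * x ^ 2 := by
    rw [← Complex.ofReal_pow, Complex.re_mul_ofReal, Complex.neg_re]
  rw [this]

theorem integral_sq_mul_cexp_neg_mul_sq {z : ℂ} (hz : 0 < z.re) :
    ∫ x in Ioi (0 : ℝ), (x : ℂ) ^ 2 * Complex.exp (-z * (x : ℂ) ^ 2) =
      (√π : ℝ) / (4 * (z * csqrt z)) := by
  have hz0 : z ≠ 0 := by rintro rfl; simp at hz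
  have hI := fun k => integrableOn_pow_mul_cexp_neg_mul_sq hz k
  have hderiv (x : ℝ) : HasDerivAt
      (fun x : ℝ => (x : ℂ) ^ 1 * Complex.exp (-z * (x : ℂ) ^ 2))
      ((x : ℂ) ^ 0 * Complex.exp (-z * (x : ℂ) ^ 2)
        - 2 * z * ((x : ℂ) ^ 2 * Complex.exp (-z * (x : ℂ) ^ 2))) x := by
    have h1 := Complex.ofRealCLM.hasDerivAt (x := x)
    have h := (h1.pow 1).mul (((h1.pow 2).const_mul (-z)).cexp)
    refine h.congr_deriv ?_
    simp
    ring
  have h_int := (hI 0).sub ((hI 2).const_mul (2 * z))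
  have h := integral_Ioi_of_hasDerivAt_of_tendsto' (fun x _ => hderiv x) h_int
    (tendsto_zero_of_hasDerivAt_of_integrableOn_Ioi (a := 0) (fun x _ => hderiv x) h_int (hI 1))
  rw [integral_sub (hI 0) ((hI 2).const_mul (2 * z)), integral_const_mul] at h
  simp only [pow_zero, one_mul] at h
  rw [integral_gaussian_complex_Ioi hz, pi_div_cpow_half hz] at h
  simp only [Complex.ofReal_zero, pow_one, zero_mul, sub_zero] at h
  have h0 := csqrt_ne_zero hz
  field_simp at h ⊢
  linear_combination -h

theorem integral_cexp_neg_mul_mul_sqrt {z : ℂ} (hz : 0 < z.re) :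
    ∫ u in Ioi (0 : ℝ), Complex.exp (-z * u) * (√u : ℝ) =
      (√π : ℝ) / (2 * (z * csqrt z)) := by
  rw [← integral_comp_rpow_Ioi_of_pos (p := 2) (by norm_num)]
  have : ∀ x ∈ Ioi (0 : ℝ), ((2 : ℝ) * x ^ ((2 : ℝ) - 1)) •
      (Complex.exp (-z * ((x ^ (2 : ℝ) : ℝ) : ℂ)) * ((√(x ^ (2 : ℝ)) : ℝ) : ℂ)) =
      2 * ((x : ℂ) ^ 2 * Complex.exp (-z * (x : ℂ) ^ 2)) := by
    intro x hx
    have hx' : (0 : ℝ) < x := hx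
    rw [Real.rpow_two, Real.sqrt_sq hx'.le, show (2 : ℝ) - 1 = 1 by norm_num, Real.rpow_one,
      Complex.real_smul]
    push_cast
    ring
  rw [setIntegral_congr_fun measurableSet_Ioi this, integral_const_mul,
    integral_sq_mul_cexp_neg_mul_sq hz]
  have h0 := csqrt_ne_zero hz
  have hz0 : z ≠ 0 := by rintro rfl; simp at hz
  field_simp
  norm_num

theorem norm_pow_mul_cexp_le {w : ℂ} (hw : w.re ≤ 0) (k : ℕ) {x : ℝ} (hx : 0 < x) :
    ‖(x : ℂ) ^ k * Complex.exp (-(x : ℂ) ^ 2 / 2 + w * x)‖ ≤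
      x ^ k * Real.exp (-(1 / 2) * x ^ 2) := by
  rw [norm_mul, norm_pow, Complex.norm_real, Complex.norm_exp, Real.norm_of_nonneg hx.le]
  have h : (-(x : ℂ) ^ 2 / 2 + w * x).re = -(1 / 2) * x ^ 2 + w.re * x := by
    rw [Complex.add_re, Complex.re_mul_ofReal,
      show -(x : ℂ) ^ 2 / 2 = ((-(1 / 2) * x ^ 2 : ℝ) : ℂ) by push_cast; ring, Complex.ofReal_re]
  rw [h]
  gcongr
  linarith [mul_nonpos_of_nonpos_of_nonneg hw hx.le]

theorem integrableOn_pow_mul_cexp {w : ℂ} (hw : w.re ≤ 0) (k : ℕ) :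
    IntegrableOn (fun x : ℝ => (x : ℂ) ^ k * Complex.exp (-(x : ℂ) ^ 2 / 2 + w * x)) (Ioi 0) :=
  (integrableOn_pow_mul_exp_neg_mul_sq one_half_pos k).mono' (by fun_prop)
    ((ae_restrict_iff' measurableSet_Ioi).2 (.of_forall fun _ hx => norm_pow_mul_cexp_le hw k hx))

theorem norm_Psi_le {w : ℂ} (hw : w.re ≤ 0) :
    ‖Psi w‖ ≤ ∫ x in Ioi (0 : ℝ), x ^ 1 * Real.exp (-(1 / 2) * x ^ 2) :=
  norm_integral_le_of_norm_le (integrableOn_pow_mul_exp_neg_mul_sq one_half_pos 1)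
    ((ae_restrict_iff' measurableSet_Ioi).2
      (.of_forall fun x hx => by simpa using norm_pow_mul_cexp_le hw 1 hx))

/-- The derivative of `Ψ`, expressed through `Ψ` by integrating by parts. -/
theorem hasDerivAt_Psi {w : ℂ} (hw : w.re < 0) :
    HasDerivAt Psi ((Psi w - 1) / w + w * Psi w) w := by
  have hw0 : w ≠ 0 := by rintro rfl; simp at hw
  have hI := fun k => integrableOn_pow_mul_cexp hw.le k
  have hexp (x : ℝ) : HasDerivAt (fun x : ℝ => Complex.exp (-(x : ℂ) ^ 2 / 2 + w * x))
      (Complex.exp (-(x : ℂ) ^ 2 / 2 + w * x) * (-(x : ℂ) + w)) x := by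
    have h1 := Complex.ofRealCLM.hasDerivAt (x := x)
    have h := ((((h1.pow 2).neg).div_const 2).add (h1.const_mul w)).cexp
    refine h.congr_deriv ?_
    simp
    ring
  have hM0 : Psi w = 1 + w * ∫ x in Ioi (0 : ℝ),
      (x : ℂ) ^ 0 * Complex.exp (-(x : ℂ) ^ 2 / 2 + w * x) := by
    have hd (x : ℝ) : HasDerivAt
        (fun x : ℝ => (x : ℂ) ^ 0 * Complex.exp (-(x : ℂ) ^ 2 / 2 + w * x))
        (w * ((x : ℂ) ^ 0 * Complex.exp (-(x : ℂ) ^ 2 / 2 + w * x)) -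
          (x : ℂ) ^ 1 * Complex.exp (-(x : ℂ) ^ 2 / 2 + w * x)) x := by
      simp only [pow_zero, one_mul]
      exact (hexp x).congr_deriv (by ring)
    have h_int := ((hI 0).const_mul w).sub (hI 1)
    have h := integral_Ioi_of_hasDerivAt_of_tendsto' (fun x _ => hd x) h_int
      (tendsto_zero_of_hasDerivAt_of_integrableOn_Ioi (a := 0) (fun x _ => hd x) h_int (hI 0))
    rw [integral_sub ((hI 0).const_mul w) (hI 1), integral_const_mul] at h
    simp only [pow_one, pow_zero, one_mul, Complex.ofReal_zero, mul_zero, add_zero,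
      ne_eq, OfNat.ofNat_ne_zero, not_false_eq_true, zero_pow, neg_zero, zero_div,
      Complex.exp_zero, zero_sub] at h ⊢
    rw [Psi]
    linear_combination -h
  have hM2 : ∫ x in Ioi (0 : ℝ), (x : ℂ) ^ 2 * Complex.exp (-(x : ℂ) ^ 2 / 2 + w * x) =
      (∫ x in Ioi (0 : ℝ), (x : ℂ) ^ 0 * Complex.exp (-(x : ℂ) ^ 2 / 2 + w * x)) + w * Psi w := by
    have hd (x : ℝ) : HasDerivAt
        (fun x : ℝ => (x : ℂ) ^ 1 * Complex.exp (-(x : ℂ) ^ 2 / 2 + w * x))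
        ((x : ℂ) ^ 0 * Complex.exp (-(x : ℂ) ^ 2 / 2 + w * x) +
          w * ((x : ℂ) ^ 1 * Complex.exp (-(x : ℂ) ^ 2 / 2 + w * x)) -
          (x : ℂ) ^ 2 * Complex.exp (-(x : ℂ) ^ 2 / 2 + w * x)) x := by
      have h := ((Complex.ofRealCLM.hasDerivAt (x := x)).pow 1).mul (hexp x)
      refine h.congr_deriv ?_
      simp
      ring
    have h_int1 : IntegrableOn (fun x : ℝ =>
        (x : ℂ) ^ 0 * Complex.exp (-(x : ℂ) ^ 2 / 2 + w * x) +
          w * ((x : ℂ) ^ 1 * Complex.exp (-(x : ℂ) ^ 2 / 2 + w * x))) (Ioi 0) :=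
      (hI 0).add ((hI 1).const_mul w)
    have h_int := h_int1.sub (hI 2)
    have h := integral_Ioi_of_hasDerivAt_of_tendsto' (fun x _ => hd x) h_int
      (tendsto_zero_of_hasDerivAt_of_integrableOn_Ioi (a := 0) (fun x _ => hd x) h_int (hI 1))
    rw [integral_sub h_int1 (hI 2), integral_add (hI 0) ((hI 1).const_mul w),
      integral_const_mul] at h
    simp only [pow_one, Complex.ofReal_zero, zero_mul, sub_zero] at h
    rw [Psi]
    linear_combination -h
  have hderiv := (hasDerivAt_integral_of_dominated_loc_of_deriv_le (𝕜 := ℂ)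
    (μ := volume.restrict (Ioi (0 : ℝ))) (s := {v : ℂ | v.re < 0}) (x₀ := w)
    (F := fun v x => (x : ℂ) * Complex.exp (-(x : ℂ) ^ 2 / 2 + v * x))
    (F' := fun v x => (x : ℂ) ^ 2 * Complex.exp (-(x : ℂ) ^ 2 / 2 + v * x))
    (bound := fun x => x ^ 2 * Real.exp (-(1 / 2) * x ^ 2))
    ((isOpen_lt Complex.continuous_re continuous_const).mem_nhds hw)
    (.of_forall fun v => by fun_prop) (by simpa [IntegrableOn] using hI 1) (by fun_prop)
    ((ae_restrict_iff' measurableSet_Ioi).2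
      (.of_forall fun x hx v hv => norm_pow_mul_cexp_le (le_of_lt hv) 2 hx))
    (integrableOn_pow_mul_exp_neg_mul_sq one_half_pos 2)
    (.of_forall fun x v _ => by
      have h := ((((hasDerivAt_id v).mul_const (x : ℂ)).const_add
        (-(x : ℂ) ^ 2 / 2)).cexp).const_mul (x : ℂ)
      refine h.congr_deriv ?_
      simp
      ring)).2
  rw [hM2] at hderiv
  refine hderiv.congr_deriv ?_
  rw [hM0]
  field_simp
  ring

/-! ### The Laplace transform of `nu` -/

theorem hasDerivAt_Psi_div_csqrt {z : ℂ} (hz : 0 < z.re) :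
    HasDerivAt (fun z => Psi (-csqrt z) / csqrt z)
      ((Psi (-csqrt z) / csqrt z - 1 / (z * csqrt z)) / 2) z := by
  have h0 := csqrt_ne_zero hz
  have hz0 : z ≠ 0 := by rintro rfl; simp at hz
  have hc := hasDerivAt_csqrt hz
  have hP := (hasDerivAt_Psi (w := -csqrt z) (by simpa using csqrt_re_pos hz)).comp z hc.neg
  refine (hP.div hc h0).congr_deriv ?_
  simp only [Function.comp]
  have hsq := csqrt_sq z
  generalize Psi (-csqrt z) = p
  generalize csqrt z = c at *
  subst hsq
  field_simp
  ring

theorem integral_exp_neg_div_eq_Psi {z : ℂ} (hz : 0 < z.re) :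
    ∫ s in Ioi (0 : ℝ), Complex.exp (-s) *
        (1 / ((z + 2 * s) * csqrt (z + 2 * s))) = Psi (-csqrt z) / csqrt z := by
  have hre {s : ℝ} (hs : 0 ≤ s) : z.re ≤ (z + 2 * s).re := by
    simpa using hs
  have hd {s : ℝ} (hs : 0 ≤ s) : HasDerivAt
      (fun s : ℝ => Complex.exp (-s) * (Psi (-csqrt (z + 2 * s)) / csqrt (z + 2 * s)))
      (-(Complex.exp (-s) * (1 / ((z + 2 * s) * csqrt (z + 2 * s))))) s := by
    have h1 := Complex.ofRealCLM.hasDerivAt (x := s)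
    have h2 := HasDerivAt.comp s (hasDerivAt_Psi_div_csqrt (hz.trans_le (hre hs)))
      ((h1.const_mul 2).const_add z)
    refine (h1.neg.cexp.mul h2).congr_deriv ?_
    simp
    ring
  have hsq {s : ℝ} (hs : 0 ≤ s) : √z.re ≤ ‖csqrt (z + 2 * s)‖ :=
    (Real.sqrt_le_sqrt (hre hs)).trans sqrt_re_le_norm_csqrt
  have hsqpos : 0 < √z.re := Real.sqrt_pos.2 hz
  have hcont : ContinuousOn (fun s : ℝ => csqrt (z + 2 * s)) (Ioi 0) := fun s hs =>
    ((hasDerivAt_csqrt (hz.trans_le (hre (le_of_lt hs)))).continuousAt.comp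
      (f := fun s : ℝ => z + 2 * (s : ℂ)) (by fun_prop)).continuousWithinAt
  have hne {s : ℝ} (hs : 0 ≤ s) : csqrt (z + 2 * s) ≠ 0 := csqrt_ne_zero (hz.trans_le (hre hs))
  have hne' {s : ℝ} (hs : 0 ≤ s) : z + 2 * s ≠ 0 := by
    intro h
    have := hre hs
    rw [h] at this
    exact hz.not_ge this
  have hexp (s : ℝ) : ‖Complex.exp (-s)‖ = Real.exp (-s) := by
    simp [Complex.norm_exp]
  have h_int' : IntegrableOn (fun s : ℝ =>
      Complex.exp (-s) * (1 / ((z + 2 * s) * csqrt (z + 2 * s)))) (Ioi 0) := by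
    refine ((integrableOn_exp_neg_Ioi 0).mul_const (1 / (z.re * √z.re))).mono' ?_
      ((ae_restrict_iff' measurableSet_Ioi).2 (.of_forall fun s hs => ?_))
    · refine ContinuousOn.aestronglyMeasurable ?_ measurableSet_Ioi
      refine ContinuousOn.mul (by fun_prop) (continuousOn_const.div
        (ContinuousOn.mul (by fun_prop) hcont) fun s hs =>
          mul_ne_zero (hne' (le_of_lt hs)) (hne (le_of_lt hs)))
    · rw [norm_mul, hexp, norm_div, norm_one, norm_mul]
      have := hsq (le_of_lt hs)
      have := (hre (le_of_lt hs)).trans (Complex.re_le_norm _)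
      gcongr
  have h_int : IntegrableOn (fun s : ℝ =>
      Complex.exp (-s) * (Psi (-csqrt (z + 2 * s)) / csqrt (z + 2 * s))) (Ioi 0) := by
    refine ((integrableOn_exp_neg_Ioi 0).mul_const
      ((∫ x in Ioi (0 : ℝ), x ^ 1 * Real.exp (-(1 / 2) * x ^ 2)) / √z.re)).mono' ?_
      ((ae_restrict_iff' measurableSet_Ioi).2 (.of_forall fun s hs => ?_))
    · exact ContinuousOn.aestronglyMeasurable
        (fun s hs => (hd (le_of_lt hs)).continuousAt.continuousWithinAt) measurableSet_Ioi
    · rw [norm_mul, hexp, norm_div]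
      have := hsq (le_of_lt hs)
      have h1 := norm_Psi_le (w := -csqrt (z + 2 * s))
        (by simpa using (csqrt_re_pos (hz.trans_le (hre (le_of_lt hs)))).le)
      have := (norm_nonneg _).trans h1
      gcongr
  have h := integral_Ioi_of_hasDerivAt_of_tendsto' (fun s hs => hd hs) h_int'.neg
    (tendsto_zero_of_hasDerivAt_of_integrableOn_Ioi (fun s hs => hd (le_of_lt hs)) h_int'.neg h_int)
  rw [integral_neg] at h
  simpa using h

theorem integrableOn_exp_neg_mul_mul_sqrt {a : ℝ} (ha : 0 < a) :
    IntegrableOn (fun u : ℝ => Real.exp (-a * u) * √u) (Ioi 0) := by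
  have h := integrableOn_rpow_mul_exp_neg_mul_rpow (p := 1) (s := 1 / 2) (b := a)
    (by norm_num) one_pos ha
  simpa [Real.sqrt_eq_rpow, mul_comm] using h

theorem norm_cexp_neg_mul_ofReal (z : ℂ) (u : ℝ) :
    ‖Complex.exp (-z * u)‖ = Real.exp (-z.re * u) := by
  rw [Complex.norm_exp, Complex.re_mul_ofReal, Complex.neg_re]

theorem integrableOn_cexp_mul_nu {z : ℂ} (hz : 0 < z.re) :
    IntegrableOn (fun u : ℝ => Complex.exp (-z * u) * (nu u : ℂ)) (Ioi 0) := by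
  refine ((integrableOn_exp_neg_mul_mul_sqrt hz).mul_const (2 / √π)).mono' ?_
    ((ae_restrict_iff' measurableSet_Ioi).2 (.of_forall fun u hu => ?_))
  · unfold nu
    exact Measurable.aestronglyMeasurable (by fun_prop)
  · have hu' : (0 : ℝ) < u := hu
    have hnu : 0 ≤ nu u := by unfold nu; positivity
    rw [norm_mul, norm_cexp_neg_mul_ofReal, Complex.norm_real, Real.norm_of_nonneg hnu, mul_assoc]
    gcongr
    rw [nu, mul_comm (√u)]
    exact div_le_self (by positivity) (by linarith)

theorem laplace_nu {z : ℂ} (hz : 0 < z.re) :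
    laplace nu z = Psi (-csqrt z) / csqrt z := by
  have hpi : ((√π : ℝ) : ℂ) ≠ 0 := by
    exact_mod_cast (Real.sqrt_pos.2 Real.pi_pos).ne'
  let f : ℝ → ℝ → ℂ := fun u s => (2 / (√π : ℝ) : ℂ) *
    ((Complex.exp (-z * u) * (√u : ℝ)) * Complex.exp (-(2 * u + 1) * s))
  have hf : Integrable (Function.uncurry f)
      ((volume.restrict (Ioi (0 : ℝ))).prod (volume.restrict (Ioi (0 : ℝ)))) := by
    refine Integrable.const_mul (Integrable.mono'
      ((integrableOn_exp_neg_mul_mul_sqrt hz).mul_prod (integrableOn_exp_neg_Ioi 0)) ?_ ?_) _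
    · exact Measurable.aestronglyMeasurable (by fun_prop)
    · rw [Measure.prod_restrict]
      refine (ae_restrict_iff' (measurableSet_Ioi.prod measurableSet_Ioi)).2
        (.of_forall fun p hp => ?_)
      have h1 : (0 : ℝ) < p.1 := hp.1
      have h2 : (0 : ℝ) < p.2 := hp.2
      rw [norm_mul, norm_mul, norm_cexp_neg_mul_ofReal, Complex.norm_real,
        Real.norm_of_nonneg (Real.sqrt_nonneg _), norm_cexp_neg_mul_ofReal]
      gcongr
      simp
      nlinarith [mul_pos h1 h2]
  have hleft : laplace nu z = ∫ u in Ioi (0 : ℝ), ∫ s in Ioi (0 : ℝ), f u s := by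
    refine setIntegral_congr_fun measurableSet_Ioi fun u hu => ?_
    have hu' : (0 : ℝ) < u := hu
    have hne : (2 * u + 1 : ℂ) ≠ 0 := by
      exact_mod_cast (by positivity : (2 * u + 1 : ℝ) ≠ 0)
    simp only [f]
    rw [integral_const_mul, integral_const_mul, integral_exp_mul_complex_Ioi
      (by simp; linarith), nu]
    push_cast
    rw [mul_zero, Complex.exp_zero, neg_div_neg_eq]
    field_simp
  rw [hleft, integral_integral_swap hf, ← integral_exp_neg_div_eq_Psi hz]
  refine setIntegral_congr_fun measurableSet_Ioi fun s hs => ?_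
  have hs' : (0 : ℝ) < s := hs
  have hre : 0 < (z + 2 * s).re := by simp; linarith
  have hfs (u : ℝ) : f u s = (2 / (√π : ℝ) : ℂ) * Complex.exp (-s) *
      (Complex.exp (-(z + 2 * s) * u) * (√u : ℝ)) := by
    have : Complex.exp (-z * u) * Complex.exp (-(2 * u + 1) * s) =
        Complex.exp (-s) * Complex.exp (-(z + 2 * s) * u) := by
      rw [← Complex.exp_add, ← Complex.exp_add]
      ring_nf
    simp only [f]
    linear_combination (2 / (√π : ℝ) : ℂ) * (√u : ℝ) * this
  simp only [hfs]
  rw [integral_const_mul, integral_cexp_neg_mul_mul_sqrt hre]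
  have h0 := csqrt_ne_zero hre
  have hne : z + 2 * s ≠ 0 := by
    intro h
    rw [h] at hre
    exact lt_irrefl _ hre
  field_simp

/-! ### Laplace transforms of convolutions -/

theorem cexp_mul_pconv (f g : ℝ → ℝ) (z : ℂ) (u : ℝ) :
    Complex.exp (-z * u) * (pconv f g u : ℂ) =
      ∫ s in (0 : ℝ)..u, ContinuousLinearMap.mul ℝ ℂ (Complex.exp (-z * s) * (f s : ℂ))
        (Complex.exp (-z * ((u - s : ℝ) : ℂ)) * (g (u - s) : ℂ)) := by
  rw [pconv, ← intervalIntegral.integral_ofReal, ← intervalIntegral.integral_const_mul]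
  refine intervalIntegral.integral_congr fun s _ => ?_
  have : Complex.exp (-z * u) = Complex.exp (-z * s) * Complex.exp (-z * ((u - s : ℝ) : ℂ)) := by
    rw [← Complex.exp_add]
    push_cast
    ring_nf
  simp only [ContinuousLinearMap.mul_apply']
  rw [this]
  push_cast
  ring

theorem integrableOn_cexp_mul_pconv {f g : ℝ → ℝ} {z : ℂ}
    (hf : IntegrableOn (fun u : ℝ => Complex.exp (-z * u) * (f u : ℂ)) (Ioi 0))
    (hg : IntegrableOn (fun u : ℝ => Complex.exp (-z * u) * (g u : ℂ)) (Ioi 0)) :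
    IntegrableOn (fun u : ℝ => Complex.exp (-z * u) * (pconv f g u : ℂ)) (Ioi 0) := by
  have h := integrable_posConvolution hf hg (ContinuousLinearMap.mul ℝ ℂ)
  rw [posConvolution, integrable_indicator_iff measurableSet_Ioi] at h
  exact h.congr_fun (fun u _ => (cexp_mul_pconv f g z u).symm) measurableSet_Ioi

theorem laplace_pconv {f g : ℝ → ℝ} {z : ℂ}
    (hf : IntegrableOn (fun u : ℝ => Complex.exp (-z * u) * (f u : ℂ)) (Ioi 0))
    (hg : IntegrableOn (fun u : ℝ => Complex.exp (-z * u) * (g u : ℂ)) (Ioi 0)) :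
    laplace (pconv f g) z = laplace f z * laplace g z := by
  have h := integral_posConvolution hf hg (ContinuousLinearMap.mul ℝ ℂ)
  rw [ContinuousLinearMap.mul_apply'] at h
  rw [laplace, laplace, laplace, ← h]
  exact setIntegral_congr_fun measurableSet_Ioi fun u _ => cexp_mul_pconv f g z u

theorem integrableOn_cexp_mul_nuPow {z : ℂ} (hz : 0 < z.re) (n : ℕ) :
    IntegrableOn (fun u : ℝ => Complex.exp (-z * u) * (nuPow (n + 1) u : ℂ)) (Ioi 0) := by
  induction n with
  | zero => exact integrableOn_cexp_mul_nu hz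
  | succ n ih => exact integrableOn_cexp_mul_pconv ih (integrableOn_cexp_mul_nu hz)

theorem laplace_nuPow_succ {z : ℂ} (hz : 0 < z.re) (n : ℕ) :
    laplace (nuPow (n + 1)) z = (Psi (-csqrt z) / csqrt z) ^ (n + 1) := by
  induction n with
  | zero => simpa [nuPow] using laplace_nu hz
  | succ n ih =>
    rw [pow_succ, ← ih, ← laplace_nu hz]
    exact laplace_pconv (integrableOn_cexp_mul_nuPow hz n) (integrableOn_cexp_mul_nu hz)

/-- For every integer `n ≥ 1` and `Re z > 0`: `L(ν^{*(n)})(z) = (Ψ(−√z)/√z)ⁿ`;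
in particular, for `n = 1`, `∫₀^∞ e^{−z·u}·(2/√π)·√u/(2u+1) du = Ψ(−√z)/√z`. -/
theorem laplace_nuPow :
    (∀ n : ℕ, 1 ≤ n → ∀ z : ℂ, 0 < z.re →
      laplace (nuPow n) z = (Psi (-csqrt z) / csqrt z) ^ n) ∧
    (∀ z : ℂ, 0 < z.re →
      (∫ u in Ioi (0:ℝ), Complex.exp (-z * u) *
          (((2 / Real.sqrt π) * Real.sqrt u / (2*u + 1) : ℝ) : ℂ)) =
        Psi (-csqrt z) / csqrt z) := by
  refine ⟨fun n hn z hz => ?_, fun z hz => laplace_nu hz⟩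
  obtain ⟨m, rfl⟩ := Nat.exists_eq_add_of_le' hn
  exact laplace_nuPow_succ hz m
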